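/- For every integer n ≥ 1: if n = m(3m+1) or n = m(3m−1) for some positive integer m, then m^o_{1,2}(n) = m^e_{1,2}(n) + (−1)^{m+1}; otherwise m^o_{1,2}(n) = m^e_{1,2}(n). Here m^o_{1,2}(n) (resp. m^e_{1,2}(n)) counts partitions of n with odd mex and an odd (resp. even) number of parts. -/

import Mathlib

/-- The mex of a partition: the smallest positive integer that is not a part. -/
noncomputable def partMex {n : ℕ} (P : Nat.Partition n) : ℕ :=
  sInf {k : ℕ | 0 < k ∧ k ∉ P.parts}

open PowerSeries PowerSeries.WithPiTopology Finset Filter Topology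

/-- The partial products of `∏ (1 - x ^ (2 * i + 1))` times the partial sums of the triangular
theta series, in closed form (a finite form of the Gauss identity, due to Shanks). -/
theorem prod_odd_mul_sum_triangular {R : Type*} [CommRing R] (x : R) (n : ℕ) :
    (∏ i ∈ range n, (1 - x ^ (2 * i + 1))) *
        ∑ j ∈ range (2 * n), x ^ (∑ i ∈ range (j + 1), i) =
      ∑ s ∈ range n, (∏ i ∈ Ico s n, (1 - x ^ (2 * i + 2))) *
        (∏ i ∈ range s, (1 - x ^ (2 * i + 1))) * x ^ (s * (2 * n + 1)) := by
  induction n with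
  | zero => simp
  | succ n ih =>
    let G : ℕ → R := fun s ↦ (1 - x ^ (2 * s)) * (∏ i ∈ Ico s n, (1 - x ^ (2 * i + 2))) *
      (∏ i ∈ range s, (1 - x ^ (2 * i + 1))) * x ^ (s * (2 * n + 1))
    have hG : ∀ s ∈ range n, (∏ i ∈ Ico s (n + 1), (1 - x ^ (2 * i + 2))) *
        (∏ i ∈ range s, (1 - x ^ (2 * i + 1))) * x ^ (s * (2 * (n + 1) + 1)) =
        (1 - x ^ (2 * n + 1)) * ((∏ i ∈ Ico s n, (1 - x ^ (2 * i + 2))) *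
        (∏ i ∈ range s, (1 - x ^ (2 * i + 1))) * x ^ (s * (2 * n + 1))) +
        (G (s + 1) - G s) := by
      intro s hs
      have hs := mem_range.mp hs
      simp only [G]
      rw [prod_Ico_succ_top hs.le, prod_eq_prod_Ico_succ_bot hs, prod_range_succ]
      ring
    have h₁ : ∑ i ∈ range (2 * n + 1), i = n * (2 * n + 1) := by
      have := sum_range_id_mul_two (2 * n + 1)
      simp only [Nat.add_sub_cancel] at this
      linarith
    rw [sum_range_succ _ n, sum_congr rfl hG, sum_add_distrib, ← mul_sum, ← ih, sum_range_sub,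
      Nat.Ico_succ_singleton, prod_singleton, show 2 * (n + 1) = 2 * n + 1 + 1 by ring,
      sum_range_succ _ (2 * n + 1), sum_range_succ _ (2 * n), sum_range_succ _ (2 * n + 1), h₁,
      prod_range_succ]
    simp only [G, Ico_self, prod_empty, mul_zero, pow_zero, sub_self, zero_mul]
    ring

theorem le_sum_range_succ_id (j : ℕ) : j ≤ ∑ i ∈ range (j + 1), i :=
  single_le_sum (f := fun i ↦ i) (by simp) (self_mem_range_succ j)

theorem summable_X_pow_triangular :
    Summable fun j : ℕ ↦ (X : ℤ⟦X⟧) ^ (∑ i ∈ range (j + 1), i) := by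
  refine summable_of_tendsto_order_atTop_nhds_top ℤ ?_
  refine ENat.tendsto_nhds_top_iff_natCast_lt.mpr fun n ↦ eventually_atTop.mpr ⟨n + 1, ?_⟩
  intro m hm
  rw [order_X_pow, Nat.cast_lt]
  exact lt_of_lt_of_le hm (le_sum_range_succ_id m)

theorem multipliable_one_sub_X_pow_odd :
    Multipliable fun n : ℕ ↦ (1 : ℤ⟦X⟧) - X ^ (2 * n + 1) := by
  simp_rw [sub_eq_add_neg]
  refine multipliable_one_add_of_tendsto_order_atTop_nhds_top ℤ ?_
  refine ENat.tendsto_nhds_top_iff_natCast_lt.mpr fun n ↦ eventually_atTop.mpr ⟨n + 1, ?_⟩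
  intro m hm
  rw [order_neg, order_X_pow, Nat.cast_lt]
  omega

theorem multipliable_one_add_X_pow :
    Multipliable fun n : ℕ ↦ (1 : ℤ⟦X⟧) + X ^ (n + 1) := by
  refine multipliable_one_add_of_tendsto_order_atTop_nhds_top ℤ ?_
  refine ENat.tendsto_nhds_top_iff_natCast_lt.mpr fun n ↦ eventually_atTop.mpr ⟨n + 1, ?_⟩
  intro m hm
  rw [order_X_pow, Nat.cast_lt]
  omega

theorem hasProd_one_sub_X_pow_even :
    HasProd (fun n : ℕ ↦ (1 : ℤ⟦X⟧) - X ^ (2 * n + 2))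
      (expand 2 two_ne_zero (pentagonalSeries ℤ)) := by
  rw [HasProd, WithPiTopology.tendsto_iff_coeff_tendsto]
  intro d
  have h : ∀ s : Finset ℕ, ∏ n ∈ s, ((1 : ℤ⟦X⟧) - X ^ (2 * n + 2)) =
      expand 2 two_ne_zero (∏ n ∈ s, (1 - X ^ (n + 1))) := by
    intro s
    simp only [map_prod, map_sub, map_one, map_pow, expand_X, ← pow_mul, mul_add, mul_one]
  simp_rw [h, coeff_expand]
  split_ifs
  · exact tendsto_nhds_of_eventually_eq (coeff_prod_one_sub_X_pow_eventually_eq ℤ _)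
  · exact tendsto_const_nhds

theorem coeff_expand_pentagonalSeries_pentagonal (k : ℤ) :
    coeff (2 * pentagonal k) (expand 2 two_ne_zero (pentagonalSeries ℤ)) = (-1) ^ k.natAbs := by
  rw [coeff_expand_mul, coeff_pentagonalSeries_pentagonal]
  simp

theorem coeff_expand_pentagonalSeries_eq_zero {n : ℕ} (h : ∀ k, n ≠ 2 * pentagonal k) :
    coeff n (expand 2 two_ne_zero (pentagonalSeries ℤ)) = 0 := by
  rw [coeff_expand]
  split_ifs with hn
  · refine coeff_pentagonalSeries_eq_zero ℤ fun ⟨k, hk⟩ ↦ h k ?_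
    omega
  · rfl

/-- **Gauss identity** for triangular numbers:
`∏ (1 - q ^ (2 * i + 1)) * ∑ q ^ (j * (j + 1) / 2) = ∏ (1 - q ^ (2 * i))`. -/
theorem tprod_odd_mul_tsum_triangular :
    (∏' n : ℕ, ((1 : ℤ⟦X⟧) - X ^ (2 * n + 1))) * ∑' j : ℕ, X ^ (∑ i ∈ range (j + 1), i) =
      expand 2 two_ne_zero (pentagonalSeries ℤ) := by
  have hO := multipliable_one_sub_X_pow_odd.hasProd.tendsto_prod_nat
  have hT := summable_X_pow_triangular.hasSum.tendsto_sum_nat.comp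
    (tendsto_id.const_mul_atTop' two_pos)
  have hE := hasProd_one_sub_X_pow_even.tendsto_prod_nat
  refine tendsto_nhds_unique (hO.mul hT) ?_
  rw [WithPiTopology.tendsto_iff_coeff_tendsto] at hE ⊢
  intro d
  refine (hE d).congr' (eventually_atTop.mpr ⟨d + 1, fun n hn ↦ ?_⟩)
  obtain ⟨n, rfl⟩ : ∃ k, n = k + 1 := ⟨n - 1, by omega⟩
  simp only [Function.comp_apply, id_eq]
  rw [prod_odd_mul_sum_triangular, sum_range_succ', map_add, map_sum, sum_eq_zero,
    zero_add, prod_range_zero, mul_one, zero_mul, pow_zero, mul_one, range_eq_Ico]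
  intro s _
  rw [coeff_mul_X_pow', if_neg]
  nlinarith

/-- The generating function for partitions signed by the parity of the number of parts. -/
noncomputable def signedGenFun : ℤ⟦X⟧ := Nat.Partition.genFun fun _ c ↦ (-1) ^ c

theorem coeff_signedGenFun (n : ℕ) :
    coeff n signedGenFun = ∑ P : n.Partition, (-1) ^ Multiset.card P.parts := by
  rw [signedGenFun, Nat.Partition.coeff_genFun]
  refine sum_congr rfl fun P _ ↦ ?_
  simp only [Finsupp.prod, Multiset.toFinsupp_support, Multiset.toFinsupp_apply]
  rw [prod_pow_eq_pow_sum, Multiset.toFinset_sum_count_eq]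

theorem signedGenFun_mul_tprod :
    signedGenFun * ∏' n : ℕ, ((1 : ℤ⟦X⟧) + X ^ (n + 1)) = 1 := by
  have h := (Nat.Partition.hasProd_genFun (R := ℤ) fun _ c ↦ (-1) ^ c).mul
    multipliable_one_add_X_pow.hasProd
  refine h.unique ?_
  convert hasProd_one using 2 with i
  have hs := summable_pow_of_constantCoeff_eq_zero (R := ℤ) (f := -X ^ (i + 1)) (by simp)
  have hone := tsum_pow_mul_one_sub_of_constantCoeff_eq_zero (R := ℤ) (f := -X ^ (i + 1)) (by simp)
  rw [hs.tsum_eq_zero_add, pow_zero, sub_neg_eq_add] at hone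
  refine Eq.trans ?_ hone
  congr! 4 with j
  rw [neg_pow (X ^ (i + 1)), ← pow_mul, smul_eq_C_mul]
  simp

theorem signedGenFun_eq_tprod :
    signedGenFun = ∏' n : ℕ, ((1 : ℤ⟦X⟧) - X ^ (2 * n + 1)) := by
  have hD := multipliable_one_add_X_pow.hasProd
  have hE := hasProd_one_sub_X_pow ℤ
  have hO := multipliable_one_sub_X_pow_odd.hasProd
  have hE₂ := hasProd_one_sub_X_pow_even
  have h₁ := (hD.mul hE).unique (by convert hE₂ using 2 with n; ring)
  have h₂ := (hO.even_mul_odd (f := fun n ↦ (1 : ℤ⟦X⟧) - X ^ (n + 1)) hE₂).unique hE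
  have hne : expand 2 two_ne_zero (pentagonalSeries ℤ) ≠ 0 := by
    intro h
    simpa [h, pentagonal_def] using coeff_expand_pentagonalSeries_pentagonal 0
  have h₃ : (∏' n : ℕ, ((1 : ℤ⟦X⟧) + X ^ (n + 1))) * ∏' n : ℕ, ((1 : ℤ⟦X⟧) - X ^ (2 * n + 1)) = 1 :=
    mul_right_cancel₀ hne (by rw [mul_assoc, h₂, h₁, one_mul])
  exact left_inv_eq_right_inv signedGenFun_mul_tprod h₃

theorem coeff_expand_pentagonalSeries (n : ℕ) :
    ∑ j ∈ range (n + 1), (if ∑ i ∈ range (j + 1), i ≤ n then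
      coeff (n - ∑ i ∈ range (j + 1), i) signedGenFun else 0) =
      coeff n (expand 2 two_ne_zero (pentagonalSeries ℤ)) := by
  rw [← tprod_odd_mul_tsum_triangular, ← signedGenFun_eq_tprod,
    ← summable_X_pow_triangular.tsum_mul_left,
    (summable_X_pow_triangular.mul_left _).map_tsum (coeff n) (continuous_coeff ℤ n),
    tsum_eq_sum (s := range (n + 1))]
  · simp_rw [coeff_mul_X_pow']
  · intro j hj
    rw [coeff_mul_X_pow', if_neg]
    have := le_sum_range_succ_id j
    simp only [mem_range] at hj
    omega

theorem Icc_val_sum (j : ℕ) : (Icc 1 j).val.sum = ∑ i ∈ range (j + 1), i := by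
  rw [range_eq_Ico, sum_eq_sum_Ico_succ_bot j.succ_pos, zero_add, sum_val]
  rfl

theorem lt_partMex_iff {n : ℕ} (P : n.Partition) (j : ℕ) :
    j < partMex P ↔ (Icc 1 j).val ≤ P.parts := by
  have hne : {k : ℕ | 0 < k ∧ k ∉ P.parts}.Nonempty :=
    ⟨n + 1, n.succ_pos, fun h ↦ by simpa using Nat.Partition.le_of_mem_parts h⟩
  rw [Multiset.le_iff_subset (Icc 1 j).nodup]
  constructor
  · intro h i hi
    rw [Finset.mem_val, mem_Icc] at hi
    by_contra hP
    exact Nat.notMem_of_lt_sInf (lt_of_le_of_lt hi.2 h) ⟨hi.1, hP⟩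
  · intro h
    by_contra! hle
    have hmem := Nat.sInf_mem hne
    exact hmem.2 (h (by rw [Finset.mem_val, mem_Icc]; exact ⟨hmem.1, hle⟩))

theorem partMex_le {n : ℕ} (P : n.Partition) : partMex P ≤ n + 1 :=
  Nat.sInf_le ⟨n.succ_pos, fun h ↦ by simpa using Nat.Partition.le_of_mem_parts h⟩

theorem sum_sign_lt_partMex (n j : ℕ) :
    (∑ P : n.Partition with j < partMex P, (-1 : ℤ) ^ Multiset.card P.parts) =
      (-1) ^ j * if ∑ i ∈ range (j + 1), i ≤ n then
        coeff (n - ∑ i ∈ range (j + 1), i) signedGenFun else 0 := by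
  have hsum := Icc_val_sum j
  split_ifs with h
  · rw [coeff_signedGenFun, mul_sum]
    refine sum_bij' (fun P hP ↦ ⟨P.parts - (Icc 1 j).val, fun hi ↦ P.parts_pos
        (Multiset.mem_of_le (Multiset.sub_le_self _ _) hi), ?_⟩)
      (fun Q _ ↦ ⟨Q.parts + (Icc 1 j).val, ?_, ?_⟩) ?_ ?_ ?_ ?_ ?_
    · have := congrArg Multiset.sum
        (tsub_add_cancel_of_le ((lt_partMex_iff P j).mp (mem_filter.mp hP).2))
      rw [Multiset.sum_add, P.parts_sum, hsum] at this
      omega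
    · intro i hi
      rcases Multiset.mem_add.mp hi with hi | hi
      · exact Q.parts_pos hi
      · rw [Finset.mem_val, mem_Icc] at hi
        exact hi.1
    · rw [Multiset.sum_add, Q.parts_sum, hsum]
      omega
    · simp
    · intro Q _
      simp [lt_partMex_iff]
    · intro P hP
      ext1
      exact tsub_add_cancel_of_le ((lt_partMex_iff P j).mp (mem_filter.mp hP).2)
    · intro Q _
      ext1
      simp
    · intro P hP
      have := congrArg Multiset.card
        (tsub_add_cancel_of_le ((lt_partMex_iff P j).mp (mem_filter.mp hP).2))
      rw [← this, Multiset.card_add, pow_add, mul_comm]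
      simp
  · rw [mul_zero, filter_eq_empty_iff.mpr, sum_empty]
    intro P _ hP
    obtain ⟨u, hu⟩ := Multiset.le_iff_exists_add.mp ((lt_partMex_iff P j).mp hP)
    have := congrArg Multiset.sum hu
    rw [Multiset.sum_add, P.parts_sum, hsum] at this
    omega

theorem sum_range_neg_one_pow (k : ℕ) :
    ∑ j ∈ range k, (-1 : ℤ) ^ j = if Odd k then 1 else 0 := by
  rw [neg_one_geom_sum]
  grind

theorem sum_sign_odd_partMex (n : ℕ) :
    (∑ P : n.Partition with Odd (partMex P), (-1 : ℤ) ^ Multiset.card P.parts) =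
      coeff n (expand 2 two_ne_zero (pentagonalSeries ℤ)) := by
  have h : ∀ P : n.Partition, (if Odd (partMex P) then (1 : ℤ) else 0) =
      ∑ j ∈ range (n + 1), if j < partMex P then (-1) ^ j else 0 := by
    intro P
    rw [← sum_range_neg_one_pow, ← sum_filter]
    congr 1
    ext j
    have := partMex_le P
    simp only [mem_range, mem_filter]
    omega
  rw [← coeff_expand_pentagonalSeries, sum_filter]
  calc ∑ P : n.Partition, (if Odd (partMex P) then (-1 : ℤ) ^ Multiset.card P.parts else 0)
      = ∑ P : n.Partition, ∑ j ∈ range (n + 1),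
          (-1) ^ j * (if j < partMex P then (-1) ^ Multiset.card P.parts else 0) := by
        refine sum_congr rfl fun P _ ↦ ?_
        rw [← one_mul ((-1 : ℤ) ^ Multiset.card P.parts), ← ite_zero_mul, h, sum_mul]
        refine sum_congr rfl fun j _ ↦ ?_
        split_ifs <;> simp
    _ = _ := by
        rw [sum_comm]
        refine sum_congr rfl fun j _ ↦ ?_
        rw [← mul_sum, ← sum_filter, sum_sign_lt_partMex, ← mul_assoc, ← mul_pow]
        simp

theorem card_even_sub_card_odd (n : ℕ) :
    (Nat.card {P : n.Partition // Odd (partMex P) ∧ Even (Multiset.card P.parts)} : ℤ) -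
      Nat.card {P : n.Partition // Odd (partMex P) ∧ Odd (Multiset.card P.parts)} =
      coeff n (expand 2 two_ne_zero (pentagonalSeries ℤ)) := by
  classical
  rw [← sum_sign_odd_partMex, Nat.card_eq_fintype_card, Nat.card_eq_fintype_card,
    Fintype.card_subtype, Fintype.card_subtype, card_filter, card_filter, sum_filter]
  push_cast
  rw [← sum_sub_distrib]
  refine sum_congr rfl fun P _ ↦ ?_
  rcases Nat.even_or_odd (Multiset.card P.parts) with hP | hP
  · simp [hP, hP.neg_one_pow, Nat.not_odd_iff_even.mpr hP]
  · by_cases hm : Odd (partMex P) <;> simp [hm, hP, hP.neg_one_pow, Nat.not_even_iff_odd.mpr hP]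

theorem two_mul_pentagonal_natCast (m : ℕ) : 2 * pentagonal m = m * (3 * m - 1) := by
  have := two_mul_natCast_pentagonal m
  rcases Nat.eq_zero_or_pos m with rfl | hm
  · simpa using this
  · zify [show 1 ≤ 3 * m by omega]
    exact this

theorem two_mul_pentagonal_neg_natCast (m : ℕ) : 2 * pentagonal (-m) = m * (3 * m + 1) := by
  exact_mod_cast two_mul_natCast_pentagonal_neg m

/-- For `n ≥ 1`: if `n = m(3m+1)` or `n = m(3m-1)` for a positive integer `m` then
`m^o_{1,2}(n) = m^e_{1,2}(n) + (-1)^{m+1}`, and otherwise `m^o_{1,2}(n) = m^e_{1,2}(n)`. -/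
theorem stmt_13 (n : ℕ) (hn : 1 ≤ n) :
    (∀ m : ℕ, 0 < m → (n = m * (3 * m + 1) ∨ n = m * (3 * m - 1)) →
      (Nat.card {P : Nat.Partition n // Odd (partMex P) ∧ Odd (Multiset.card P.parts)} : ℤ) =
        (Nat.card {P : Nat.Partition n // Odd (partMex P) ∧ Even (Multiset.card P.parts)} : ℤ) +
          (-1) ^ (m + 1)) ∧
    ((¬ ∃ m : ℕ, 0 < m ∧ (n = m * (3 * m + 1) ∨ n = m * (3 * m - 1))) →
      Nat.card {P : Nat.Partition n // Odd (partMex P) ∧ Odd (Multiset.card P.parts)} =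
        Nat.card {P : Nat.Partition n // Odd (partMex P) ∧ Even (Multiset.card P.parts)}) := by
  have hcard := card_even_sub_card_odd n
  constructor
  · rintro m - hm
    have hcoeff : coeff n (expand 2 two_ne_zero (pentagonalSeries ℤ)) = (-1) ^ m := by
      rcases hm with hm | hm
      · rw [hm, ← two_mul_pentagonal_neg_natCast, coeff_expand_pentagonalSeries_pentagonal]
        simp
      · rw [hm, ← two_mul_pentagonal_natCast, coeff_expand_pentagonalSeries_pentagonal]
        simp
    rw [pow_succ]
    linarith
  · intro hm
    have hcoeff := coeff_expand_pentagonalSeries_eq_zero (n := n) fun k hk ↦ by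
      obtain ⟨m, rfl | rfl⟩ := k.eq_nat_or_neg
      · rw [two_mul_pentagonal_natCast] at hk
        exact hm ⟨m, Nat.pos_of_ne_zero (by rintro rfl; simp at hk; omega), .inr hk⟩
      · rw [two_mul_pentagonal_neg_natCast] at hk
        exact hm ⟨m, Nat.pos_of_ne_zero (by rintro rfl; simp at hk; omega), .inl hk⟩
    omega
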